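/- Let k ≥ 1 be an integer, λ > 0, α ∈ (0,1), and t ≥ 0. Define q_{α,k}(n,t) = ∑_{r=0}^∞ ((−(kλ)^α t)^r / r!) · ∑_{x ∈ Ω(k,n)} (−1)^{ζ(x)} (∏_{l=0}^{ζ(x)−1}(αr − l)) / (Π!(x) · k^{ζ(x)}). Then for every u ∈ (0,1), ∑_{n=0}^∞ u^n q_{α,k}(n,t) = exp(−k^α λ^α t (1 − (1/k)∑_{j=1}^k u^j)^α); that is, q_{α,k}(n,t) is the probability mass function of the space-fractional Poisson process of order k. -/

import Mathlib

open scoped BigOperators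

/-- `Omega k n` is the (finite) set of tuples `(x₁,…,x_k)` of non-negative integers with
`x₁ + 2·x₂ + ⋯ + k·x_k = n`. -/
def Omega (k n : ℕ) : Finset (Fin k → ℕ) :=
  (Fintype.piFinset fun _ => Finset.range (n + 1)).filter
    (fun x => ∑ i, (i.1 + 1) * x i = n)

/-- `ζ(x) = x₁ + ⋯ + x_k`. -/
def zeta {k : ℕ} (x : Fin k → ℕ) : ℕ := ∑ i, x i

/-- `Π!(x) = x₁! ⋯ x_k!`. -/
def pifact {k : ℕ} (x : Fin k → ℕ) : ℕ := ∏ i, (x i).factorial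

/-- `c_k(n, y) = ∑_{x ∈ Ω(k,n)} y^{ζ(x)} / Π!(x)`. -/
noncomputable def ck (k n : ℕ) (y : ℝ) : ℝ :=
  ∑ x ∈ Omega k n, y ^ zeta x / (pifact x : ℝ)

/-- The pmf of the space-fractional Poisson process of order `k`:
`q_{α,k}(n,t) = ∑_{r=0}^∞ ((−(kλ)^α t)^r / r!) ∑_{x ∈ Ω(k,n)}
(−1)^{ζ(x)} (∏_{l=0}^{ζ(x)−1} (αr − l)) / (Π!(x) k^{ζ(x)})`. -/
noncomputable def qk (k : ℕ) (lam α : ℝ) (n : ℕ) (t : ℝ) : ℝ :=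
  ∑' r : ℕ, ((-((k * lam) ^ α) * t) ^ r / r.factorial) *
    ∑ x ∈ Omega k n,
      (-1 : ℝ) ^ zeta x * (∏ l ∈ Finset.range (zeta x), (α * r - l)) /
        ((pifact x : ℝ) * (k : ℝ) ^ zeta x)

noncomputable def BB (β : ℝ) (m : ℕ) : ℝ := (-1 : ℝ) ^ m * ∏ l ∈ Finset.range m, (β - l)

lemma smeval_desc (a : ℝ) (n : ℕ) :
    (descPochhammer ℤ n).smeval a = ∏ l ∈ Finset.range n, (a - l) := by
  induction n with
  | zero => simp
  | succ n ih =>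
    rw [Finset.prod_range_succ, ← ih]
    simp [descPochhammer_succ_right, Polynomial.smeval_mul, Polynomial.smeval_natCast]

lemma BB_hasSum (β v : ℝ) (h0 : 0 ≤ v) (h1 : v < 1) :
    HasSum (fun m : ℕ => BB β m / m.factorial * v ^ m) ((1 - v) ^ β) := by
  have h := (Real.one_add_rpow_hasFPowerSeriesOnBall_zero (a := β)).hasSum (y := -v) (by
    rw [← ENNReal.ofReal_one, Metric.eball_ofReal]
    simp [abs_of_nonneg h0, h1])
  simp only [binomialSeries_apply, ← sub_eq_add_neg] at h
  suffices he : (fun m : ℕ => BB β m / m.factorial * v ^ m) =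
      fun m : ℕ => Ring.choose β m • (List.ofFn fun _ : Fin m => -v).prod by
    rw [he]; simpa only [zero_sub, ← sub_eq_add_neg] using h
  funext m
  have hc := Ring.descPochhammer_eq_factorial_smul_choose β m
  rw [smeval_desc, nsmul_eq_mul] at hc
  have hf : (m.factorial : ℝ) ≠ 0 := by positivity
  rw [BB, hc]
  simp only [List.ofFn_const, List.prod_replicate, smul_eq_mul]
  rw [neg_pow v]
  field_simp

lemma BB_abs (β : ℝ) (hβ : 0 ≤ β) (m : ℕ) : |BB β m| ≤ BB (-β) m := by
  have h : BB (-β) m = ∏ l ∈ Finset.range m, (β + l) := by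
    rw [BB, ← Finset.card_range m, ← Finset.prod_const, Finset.card_range,
      ← Finset.prod_mul_distrib]
    exact Finset.prod_congr rfl fun _ _ => by ring
  rw [h, BB, abs_mul, abs_pow, abs_neg, abs_one, one_pow, one_mul, Finset.abs_prod]
  refine Finset.prod_le_prod (fun _ _ => abs_nonneg _) fun l _ => ?_
  have : (0 : ℝ) ≤ l := by positivity
  rw [abs_le]; constructor <;> linarith

def partEquiv {X : Type} (f : X → ℕ) (S : ℕ → Finset X) (hS : ∀ n x, x ∈ S n ↔ f x = n) :
    (Σ n, {x // x ∈ S n}) ≃ X where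
  toFun p := p.2.1
  invFun x := ⟨f x, x, (hS _ _).2 rfl⟩
  left_inv := by
    rintro ⟨n, x, hx⟩
    obtain rfl := (hS _ _).1 hx
    rfl
  right_inv _ := rfl

lemma part_hasSum {X : Type} (f : X → ℕ) (S : ℕ → Finset X) (hS : ∀ n x, x ∈ S n ↔ f x = n)
    (g : X → ℝ) (a : ℝ) (h : HasSum g a) : HasSum (fun n => ∑ x ∈ S n, g x) a := by
  have h' := (partEquiv f S hS).hasSum_iff.2 h
  exact h'.sigma fun n => (S n).hasSum g

lemma part_summable {X : Type} (f : X → ℕ) (S : ℕ → Finset X) (hS : ∀ n x, x ∈ S n ↔ f x = n)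
    (g : X → ℝ) (hg : ∀ x, 0 ≤ g x) (h : Summable (fun n => ∑ x ∈ S n, g x)) : Summable g := by
  rw [← (partEquiv f S hS).summable_iff]
  refine (summable_sigma_of_nonneg (fun _ => hg _)).2 ?_
  refine ⟨fun n => ((S n).hasSum g).summable, ?_⟩
  convert h using 2 with n
  exact ((S n).hasSum g).tsum_eq

lemma mem_Omega (k n : ℕ) (x : Fin k → ℕ) : x ∈ Omega k n ↔ ∑ i, (i.1 + 1) * x i = n := by
  simp only [Omega, Finset.mem_filter, Fintype.mem_piFinset, Finset.mem_range]
  refine ⟨fun h => h.2, fun h => ⟨fun i => ?_, h⟩⟩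
  have := Finset.single_le_sum (f := fun i : Fin k => (i.1 + 1) * x i) (fun _ _ => Nat.zero_le _)
    (Finset.mem_univ i)
  nlinarith [Nat.zero_le (i.1 * x i)]

noncomputable def gg (k : ℕ) (u : ℝ) (b : ℕ → ℝ) (x : Fin k → ℕ) : ℝ :=
  b (zeta x) / ((pifact x : ℝ) * (k : ℝ) ^ zeta x) * ∏ i, (u ^ (i.1 + 1)) ^ x i

lemma gg_Omega (k : ℕ) (u : ℝ) (b : ℕ → ℝ) (n : ℕ) :
    ∑ x ∈ Omega k n, gg k u b x =
      u ^ n * ∑ x ∈ Omega k n, b (zeta x) / ((pifact x : ℝ) * (k : ℝ) ^ zeta x) := by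
  rw [Finset.mul_sum]
  refine Finset.sum_congr rfl fun x hx => ?_
  rw [mem_Omega] at hx
  rw [gg, mul_comm]
  congr 1
  simp_rw [← pow_mul]
  rw [Finset.prod_pow_eq_pow_sum, hx]

lemma gg_anti (k : ℕ) (u : ℝ) (b : ℕ → ℝ) (m : ℕ) :
    ∑ x ∈ Finset.piAntidiag (Finset.univ : Finset (Fin k)) m, gg k u b x =
      b m / m.factorial * ((1 / k) * ∑ j ∈ Finset.range k, u ^ (j + 1)) ^ m := by
  rw [Finset.sum_range (fun j => u ^ (j + 1)), mul_pow,
    Finset.sum_pow_eq_sum_piAntidiag, Finset.mul_sum, Finset.mul_sum]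
  refine Finset.sum_congr rfl fun x hx => ?_
  have hz : zeta x = m := by simpa [zeta] using hx
  have hs := Nat.multinomial_spec (Finset.univ : Finset (Fin k)) x
  have hs' : (pifact x : ℝ) * (Nat.multinomial Finset.univ x : ℕ) = (m.factorial : ℕ) := by
    rw [← hz]; exact_mod_cast hs
  have hp : (pifact x : ℝ) ≠ 0 := by
    have : 0 < pifact x := Finset.prod_pos fun i _ => Nat.factorial_pos _
    positivity
  have hf : (m.factorial : ℝ) ≠ 0 := by positivity
  have hM : (Nat.multinomial Finset.univ x : ℝ) = m.factorial / pifact x := by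
    rw [eq_div_iff hp, ← hs']; ring
  rw [gg, hz, hM, one_div, inv_pow]
  field_simp

lemma gg_hasSum (k : ℕ) (u : ℝ) (hu : 0 ≤ u) (b : ℕ → ℝ) (v a : ℝ)
    (hv : v = (1 / k) * ∑ j ∈ Finset.range k, u ^ (j + 1))
    (hs : Summable fun m : ℕ => |b m| / m.factorial * v ^ m)
    (ha : HasSum (fun m : ℕ => b m / m.factorial * v ^ m) a) :
    HasSum (fun n => u ^ n * ∑ x ∈ Omega k n,
      b (zeta x) / ((pifact x : ℝ) * (k : ℝ) ^ zeta x)) a := by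
  have hS : ∀ n (x : Fin k → ℕ), x ∈ Finset.piAntidiag (Finset.univ : Finset (Fin k)) n ↔
      zeta x = n := by intro n x; simp [zeta]
  have habs : ∀ x, gg k u (fun m => |b m|) x = |gg k u b x| := by
    intro x
    have h1 : (0 : ℝ) ≤ (pifact x : ℝ) * (k : ℝ) ^ zeta x := by positivity
    have h2 : 0 ≤ ∏ i : Fin k, (u ^ (i.1 + 1)) ^ x i := by positivity
    rw [gg, gg, abs_mul, abs_div, abs_of_nonneg h1, abs_of_nonneg h2]
  have hsum : Summable (gg k u b) := by
    apply Summable.of_abs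
    apply part_summable zeta _ hS _ (fun _ => abs_nonneg _)
    simp_rw [← habs, gg_anti, ← hv]
    exact hs
  have h1 := part_hasSum zeta _ hS _ _ hsum.hasSum
  simp_rw [gg_anti, ← hv] at h1
  have h2 := part_hasSum (fun x : Fin k → ℕ => ∑ i, (i.1 + 1) * x i) (Omega k)
    (mem_Omega k) _ _ hsum.hasSum
  simp_rw [gg_Omega] at h2
  rwa [h1.unique ha] at h2

/-- The probability generating function of the space-fractional Poisson process of order `k`:
`∑_{n=0}^∞ uⁿ q_{α,k}(n,t) = exp(−k^α λ^α t (1 − (1/k)∑_{j=1}^k u^j)^α)` for `u ∈ (0,1)`. -/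
theorem pgf_space_fractional_poisson_of_order_k
    (k : ℕ) (hk : 1 ≤ k) (lam α t : ℝ) (hlam : 0 < lam) (hα : α ∈ Set.Ioo (0 : ℝ) 1)
    (ht : 0 ≤ t) (u : ℝ) (hu : u ∈ Set.Ioo (0 : ℝ) 1) :
    ∑' n : ℕ, u ^ n * qk k lam α n t =
      Real.exp (-((k : ℝ) ^ α * lam ^ α * t *
        (1 - (1 / k) * ∑ j ∈ Finset.range k, u ^ (j + 1)) ^ α)) := by
  obtain ⟨hu0, hu1⟩ := hu
  obtain ⟨hα0, hα1⟩ := hα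
  obtain ⟨v, hv⟩ : ∃ v, v = (1 / (k : ℝ)) * ∑ j ∈ Finset.range k, u ^ (j + 1) := ⟨_, rfl⟩
  have hk0 : (0 : ℝ) < k := by exact_mod_cast hk
  have hv0 : 0 ≤ v := by rw [hv]; positivity
  have hv1 : v < 1 := by
    have : ∑ j ∈ Finset.range k, u ^ (j + 1) < ∑ j ∈ Finset.range k, (1 : ℝ) := by
      refine Finset.sum_lt_sum_of_nonempty (by simp; omega) fun j _ => ?_
      exact pow_lt_one₀ hu0.le hu1 (by omega)
    simp only [Finset.sum_const, Finset.card_range, nsmul_eq_mul, mul_one] at this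
    rw [hv, one_div, inv_mul_lt_iff₀ hk0]; linarith
  rw [← hv]
  obtain ⟨c, hc⟩ : ∃ c, c = -((k * lam) ^ α) * t := ⟨_, rfl⟩
  -- inner sums
  let T : ℝ → ℕ → ℝ := fun β n => ∑ x ∈ Omega k n,
      BB β (zeta x) / ((pifact x : ℝ) * (k : ℝ) ^ zeta x)
  have hpos : ∀ β : ℝ, 0 ≤ β → ∀ m, 0 ≤ BB (-β) m := fun β hβ m =>
    (abs_nonneg _).trans (BB_abs β hβ m)
  have hTneg : ∀ β : ℝ, 0 ≤ β → HasSum (fun n => u ^ n * T (-β) n) ((1 - v) ^ (-β)) := by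
    intro β hβ
    refine gg_hasSum k u hu0.le (BB (-β)) v _ hv ?_ (BB_hasSum _ v hv0 hv1)
    simp_rw [abs_of_nonneg (hpos β hβ _)]
    exact (BB_hasSum _ v hv0 hv1).summable
  have hT : ∀ β : ℝ, 0 ≤ β → HasSum (fun n => u ^ n * T β n) ((1 - v) ^ β) := by
    intro β hβ
    refine gg_hasSum k u hu0.le (BB β) v _ hv ?_ (BB_hasSum _ v hv0 hv1)
    refine Summable.of_nonneg_of_le (fun m => by positivity) (fun m => ?_)
      (BB_hasSum (-β) v hv0 hv1).summable
    have := BB_abs β hβ m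
    gcongr
  have hTle : ∀ β : ℝ, 0 ≤ β → ∀ n, |T β n| ≤ T (-β) n := by
    intro β hβ n
    refine (Finset.abs_sum_le_sum_abs _ _).trans (Finset.sum_le_sum fun x _ => ?_)
    have h1 : (0 : ℝ) ≤ (pifact x : ℝ) * (k : ℝ) ^ zeta x := by positivity
    rw [abs_div, abs_of_nonneg h1]
    have := BB_abs β hβ (zeta x)
    gcongr
  have hβ : ∀ r : ℕ, 0 ≤ α * r := fun r => by positivity
  let G : ℕ × ℕ → ℝ := fun p => (|c| ^ p.1 / p.1.factorial) * (u ^ p.2 * T (-(α * p.1)) p.2)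
  let H : ℕ × ℕ → ℝ := fun p => (c ^ p.1 / p.1.factorial) * (u ^ p.2 * T (α * p.1) p.2)
  have hHG : ∀ p, |H p| ≤ G p := by
    intro p
    have := hTle _ (hβ p.1) p.2
    simp only [H, G, abs_mul, abs_div, abs_pow, abs_of_pos hu0, Nat.abs_cast]
    gcongr
  have hexp : ∀ z : ℝ, HasSum (fun r : ℕ => z ^ r / r.factorial) (Real.exp z) := by
    intro z
    rw [Real.exp_eq_exp_ℝ]
    exact NormedSpace.expSeries_div_hasSum_exp z
  have hpw : ∀ (β : ℝ) (r : ℕ), (1 - v) ^ (β * r) = ((1 - v) ^ β) ^ r := by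
    intro β r
    rw [Real.rpow_mul (by linarith), Real.rpow_natCast]
  have hG : Summable G := by
    rw [summable_prod_of_nonneg (fun p => (abs_nonneg _).trans (hHG p))]
    refine ⟨fun r => ((hTneg _ (hβ r)).summable.mul_left (|c| ^ r / r.factorial)), ?_⟩
    refine (hexp (|c| * (1 - v) ^ (-α))).summable.congr fun r => ?_
    simp only [G]
    rw [tsum_mul_left, (hTneg _ (hβ r)).tsum_eq, ← neg_mul, hpw, mul_pow]
    ring
  have hH : Summable H := Summable.of_norm_bounded hG hHG
  have hq : ∀ n, u ^ n * qk k lam α n t = ∑' r, H (r, n) := by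
    intro n
    rw [qk, ← tsum_mul_left, ← hc]
    refine tsum_congr fun r => ?_
    simp only [H, T, BB]
    ring
  simp_rw [hq]
  rw [Summable.tsum_comm (f := fun r n => H (r, n)) hH]
  have hin : ∀ r, ∑' n, H (r, n) = (c * (1 - v) ^ α) ^ r / r.factorial := by
    intro r
    simp only [H]
    rw [tsum_mul_left, (hT _ (hβ r)).tsum_eq, hpw, mul_pow]
    ring
  simp_rw [hin]
  rw [(hexp _).tsum_eq, hc, Real.mul_rpow hk0.le hlam.le]
  congr 1
  ring
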